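/- Let N be a nilpotent left Leibniz algebra of class t and let A = N^i for some i ≥ 2 with dim A ≥ 2, A non-abelian, dim Z(A) = 1. Then Z(A) ⊆ Z(N) and N^t = Z(A). -/

import Mathlib

open Polynomial LinearMap

/-- A (left) Leibniz algebra structure on the `K`-vector space `A`:
a bilinear multiplication satisfying `x(yz) = (xy)z + y(xz)`. -/
structure LeibnizMul (K A : Type*) [Field K] [AddCommGroup A] [Module K A] where
  mul : A →ₗ[K] A →ₗ[K] A
  leibniz : ∀ x y z, mul x (mul y z) = mul (mul x y) z + mul y (mul x z)

namespace LeibnizMul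

variable {K A : Type*} [Field K] [AddCommGroup A] [Module K A]

/-- The product of two subspaces: the span of all products `s·t`, `s ∈ S`, `t ∈ T`. -/
def mulSub (m : LeibnizMul K A) (S T : Submodule K A) : Submodule K A :=
  Submodule.span K (Set.image2 (fun x y => m.mul x y) (S : Set A) (T : Set A))

/-- Relative lower central series of the subalgebra `S`: `lcsIn m S n = S^(n+1)`,
i.e. `lcsIn m S 0 = S` and `lcsIn m S (n+1) = S · (lcsIn m S n)`. -/
def lcsIn (m : LeibnizMul K A) (S : Submodule K A) : ℕ → Submodule K A
  | 0 => S
  | (n+1) => m.mulSub S (m.lcsIn S n)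

/-- `A` is nilpotent: some term of the lower central series vanishes. -/
def IsNilpotent (m : LeibnizMul K A) : Prop := ∃ n, m.lcsIn ⊤ n = ⊥

/-- `S` is a subalgebra: a subspace closed under multiplication. -/
def IsSubalg (m : LeibnizMul K A) (S : Submodule K A) : Prop :=
  ∀ x ∈ S, ∀ y ∈ S, m.mul x y ∈ S

/-- `S` is a (two-sided) ideal. -/
def IsIdeal (m : LeibnizMul K A) (S : Submodule K A) : Prop :=
  ∀ (x : A), ∀ y ∈ S, m.mul x y ∈ S ∧ m.mul y x ∈ S

/-- `M` is a maximal (proper) subalgebra. -/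
def IsMaxSubalg (m : LeibnizMul K A) (M : Submodule K A) : Prop :=
  m.IsSubalg M ∧ M ≠ ⊤ ∧ ∀ S, m.IsSubalg S → M < S → S = ⊤

/-- The Frattini subalgebra: the intersection of all maximal subalgebras. -/
def frattini (m : LeibnizMul K A) : Submodule K A :=
  sInf {M | m.IsMaxSubalg M}

/-- The subalgebra generated by a single element `a`. -/
def subalgGen (m : LeibnizMul K A) (a : A) : Submodule K A :=
  sInf {S | m.IsSubalg S ∧ a ∈ S}

/-- The normal closure of a subspace: the smallest ideal containing it. -/
def normalClosure (m : LeibnizMul K A) (S : Submodule K A) : Submodule K A :=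
  sInf {I | m.IsIdeal I ∧ S ≤ I}

/-- The normalizer of a subspace `C`: all `x` with `x·c ∈ C` and `c·x ∈ C` for all `c ∈ C`. -/
def normalizer (m : LeibnizMul K A) (C : Submodule K A) : Submodule K A :=
  ⨅ c : C, (Submodule.comap (m.mul.flip (c : A)) C ⊓ Submodule.comap (m.mul (c : A)) C)

/-- The center of the subalgebra `S`: all `z ∈ S` with `z·x = x·z = 0` for all `x ∈ S`. -/
def centerIn (m : LeibnizMul K A) (S : Submodule K A) : Submodule K A :=
  S ⊓ ⨅ x : S, (LinearMap.ker (m.mul.flip (x : A)) ⊓ LinearMap.ker (m.mul (x : A)))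

/-- All `z ∈ S` with `z·x ∈ T` and `x·z ∈ T` for all `x ∈ S`. -/
def relCentralizer (m : LeibnizMul K A) (S T : Submodule K A) : Submodule K A :=
  S ⊓ ⨅ x : S, (Submodule.comap (m.mul.flip (x : A)) T ⊓ Submodule.comap (m.mul (x : A)) T)

/-- The upper central series of the subalgebra `S`:
`Z₀ = 0`, `Z_{j+1} = {z ∈ S : zS ⊆ Z_j and Sz ⊆ Z_j}`. -/
def ucsIn (m : LeibnizMul K A) (S : Submodule K A) : ℕ → Submodule K A
  | 0 => ⊥
  | (j+1) => m.relCentralizer S (m.ucsIn S j)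

/-- The right center `{r : A·r = 0}`. -/
def rightCenter (m : LeibnizMul K A) : Submodule K A := LinearMap.ker m.mul.flip

/-- Left-normed powers of `a`: `lpow m a k = a^(k+1)`. -/
def lpow (m : LeibnizMul K A) (a : A) : ℕ → A
  | 0 => a
  | (k+1) => m.mul a (m.lpow a k)

/-- The Fitting null component of left multiplication by `a`. -/
def fittingNull (m : LeibnizMul K A) (a : A) : Submodule K A :=
  ⨆ k, LinearMap.ker ((m.mul a) ^ k)

end LeibnizMul

namespace LeibnizMul

variable {K A : Type*} [Field K] [AddCommGroup A] [Module K A] (m : LeibnizMul K A)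

lemma mul_mem_mulSub {S T : Submodule K A} {x y : A} (hx : x ∈ S) (hy : y ∈ T) :
    m.mul x y ∈ m.mulSub S T :=
  Submodule.subset_span ⟨x, hx, y, hy, rfl⟩

lemma mul_mul_left (x y z : A) :
    m.mul (m.mul x y) z = m.mul x (m.mul y z) - m.mul y (m.mul x z) := by
  rw [m.leibniz x y z, add_sub_cancel_right]

lemma mem_centerIn {S : Submodule K A} {z : A} :
    z ∈ m.centerIn S ↔ z ∈ S ∧ ∀ x ∈ S, m.mul z x = 0 ∧ m.mul x z = 0 := by
  simp [centerIn, Submodule.mem_iInf]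

lemma mul_mem_lcsIn_succ (x : A) {y : A} {n : ℕ} (hy : y ∈ m.lcsIn ⊤ n) :
    m.mul x y ∈ m.lcsIn ⊤ (n + 1) :=
  m.mul_mem_mulSub Submodule.mem_top hy

/-- The lower central series is graded: `N^(a+1) · N^(b+1) ⊆ N^(a+b+2)`. -/
lemma mul_mem_lcsIn {a b : ℕ} {x y : A} (hx : x ∈ m.lcsIn ⊤ a) (hy : y ∈ m.lcsIn ⊤ b) :
    m.mul x y ∈ m.lcsIn ⊤ (a + b + 1) := by
  induction a generalizing b x y with
  | zero =>
    rw [Nat.zero_add]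
    exact m.mul_mem_lcsIn_succ x hy
  | succ a ih =>
    induction hx using Submodule.span_induction with
    | mem _ h =>
      obtain ⟨u, hu, v, hv, rfl⟩ := h
      simp only [mul_mul_left]
      refine Submodule.sub_mem _ ?_ ?_
      · rw [show a + 1 + b + 1 = a + b + 1 + 1 by lia]
        exact m.mul_mem_lcsIn_succ u (ih hv hy)
      · rw [show a + 1 + b + 1 = a + (b + 1) + 1 by lia]
        exact ih hv (m.mul_mem_lcsIn_succ u hy)
    | zero => simp
    | add u v _ _ hu hv => simpa using add_mem hu hv
    | smul c u _ hu => simpa using Submodule.smul_mem _ c hu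

lemma mul_mem_lcsIn_succ_of_left {n : ℕ} {x : A} (hx : x ∈ m.lcsIn ⊤ n) (y : A) :
    m.mul x y ∈ m.lcsIn ⊤ (n + 1) := by
  have hy : y ∈ m.lcsIn ⊤ 0 := Submodule.mem_top
  simpa only [Nat.add_zero] using m.mul_mem_lcsIn hx hy

lemma lcsIn_top_antitone : Antitone (m.lcsIn ⊤) := by
  refine antitone_nat_of_succ_le fun n => ?_
  induction n with
  | zero => exact le_top
  | succ n ih => exact Submodule.span_mono (Set.image2_subset_left ih)

lemma isIdeal_lcsIn_top (n : ℕ) : m.IsIdeal (m.lcsIn ⊤ n) := fun x _ hy =>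
  ⟨m.lcsIn_top_antitone n.le_succ (m.mul_mem_lcsIn_succ x hy),
    m.lcsIn_top_antitone n.le_succ (m.mul_mem_lcsIn_succ_of_left hy x)⟩

variable {m}

/-- The center of an ideal is an ideal of the whole algebra. -/
lemma IsIdeal.centerIn {S : Submodule K A} (hS : m.IsIdeal S) : m.IsIdeal (m.centerIn S) := by
  intro n z hz
  rw [mem_centerIn] at hz
  obtain ⟨hzS, hz⟩ := hz
  simp only [mem_centerIn]
  refine ⟨⟨(hS n z hzS).1, fun a ha => ⟨?_, ?_⟩⟩, ⟨(hS n z hzS).2, fun a ha => ⟨?_, ?_⟩⟩⟩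
  · rw [mul_mul_left, (hz a ha).1, (hz _ (hS n a ha).1).1, map_zero, sub_zero]
  · rw [m.leibniz, (hz _ (hS n a ha).2).2, (hz a ha).2, map_zero, add_zero]
  · rw [mul_mul_left, (hz a ha).1, (hz _ (hS n a ha).1).1, map_zero, sub_zero]
  · rw [m.leibniz, (hz a ha).2, (hz _ (hS n a ha).2).1, map_zero, LinearMap.zero_apply, add_zero]

/-- In a nilpotent algebra, an endomorphism that shifts the lower central series kills all its
eigenvectors. -/
lemma IsNilpotent.eq_zero_of_shift (hm : m.IsNilpotent) {f : A →ₗ[K] A}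
    (hf : ∀ j, ∀ x ∈ m.lcsIn ⊤ j, f x ∈ m.lcsIn ⊤ (j + 1)) {z : A} {c : K}
    (hz : f z = c • z) : f z = 0 := by
  obtain ⟨t, ht⟩ := hm
  rcases eq_or_ne c 0 with rfl | hc
  · rw [hz, zero_smul]
  have hmem : ∀ j, z ∈ m.lcsIn ⊤ j := fun j => by
    induction j with
    | zero => exact Submodule.mem_top
    | succ j ih => exact (Submodule.smul_mem_iff _ hc).1 (hz ▸ hf j z ih)
  have hz0 : z = 0 := by simpa [ht] using hmem t
  rw [hz0, map_zero]

/-- In a nilpotent algebra, one-dimensional ideals are central. -/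
lemma IsNilpotent.le_centerIn_top_of_finrank_eq_one (hm : m.IsNilpotent) {I : Submodule K A}
    (hI : m.IsIdeal I) (h1 : Module.finrank K I = 1) : I ≤ m.centerIn ⊤ := by
  intro z hz
  refine m.mem_centerIn.2 ⟨Submodule.mem_top, fun n _ => ?_⟩
  rcases eq_or_ne z 0 with rfl | hz0
  · simp
  have hspan : ∀ w ∈ I, ∃ c : K, w = c • z := fun w hw => by
    obtain ⟨c, hc⟩ := (finrank_eq_one_iff_of_nonzero' (⟨z, hz⟩ : I) (by simpa using hz0)).1 h1
      ⟨w, hw⟩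
    exact ⟨c, (congrArg Subtype.val hc).symm⟩
  obtain ⟨c, hc⟩ := hspan _ (hI n z hz).1
  obtain ⟨d, hd⟩ := hspan _ (hI n z hz).2
  exact ⟨hm.eq_zero_of_shift (f := m.mul.flip n)
      (fun _ _ hx => m.mul_mem_lcsIn_succ_of_left hx n) hd,
    hm.eq_zero_of_shift (f := m.mul n) (fun _ _ hx => m.mul_mem_lcsIn_succ n hx) hc⟩

variable (m) in
/-- The last nonzero term of the lower central series is central. -/
lemma lcsIn_top_le_centerIn_top {n : ℕ} (h : m.lcsIn ⊤ (n + 1) = ⊥) :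
    m.lcsIn ⊤ n ≤ m.centerIn ⊤ := by
  intro z hz
  refine m.mem_centerIn.2 ⟨Submodule.mem_top, fun x _ => ?_⟩
  rw [← Submodule.mem_bot K, ← Submodule.mem_bot K, ← h]
  exact ⟨m.mul_mem_lcsIn_succ_of_left hz x, m.mul_mem_lcsIn_succ x hz⟩

end LeibnizMul

/-- let `N` be nilpotent of class `t` and `A = N^i` (`i ≥ 2`) with
`dim A ≥ 2`, `A` non-abelian and `dim Z(A) = 1`.  Then `Z(A) ⊆ Z(N)` and `N^t = Z(A)`.
(`lcsIn mN ⊤ (k-1) = N^k`.) -/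
theorem stmt17 {K N : Type*} [Field K] [AddCommGroup N] [Module K N] [FiniteDimensional K N]
    (mN : LeibnizMul K N) (t : ℕ) (ht : 1 ≤ t)
    (hclass : mN.lcsIn ⊤ t = ⊥ ∧ mN.lcsIn ⊤ (t - 1) ≠ ⊥)
    (i : ℕ) (hi : 2 ≤ i)
    (A : Submodule K N) (hA : A = mN.lcsIn ⊤ (i - 1))
    (hdim : 2 ≤ Module.finrank K ↥A)
    (hnonab : mN.mulSub A A ≠ ⊥)
    (hz : Module.finrank K ↥(mN.centerIn A) = 1) :
    mN.centerIn A ≤ mN.centerIn ⊤ ∧ mN.lcsIn ⊤ (t - 1) = mN.centerIn A := by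
  obtain ⟨ht0, ht1⟩ := hclass
  obtain ⟨s, rfl⟩ := Nat.exists_eq_add_of_le' ht
  rw [Nat.add_sub_cancel] at ht1 ⊢
  have hideal : mN.IsIdeal A := hA ▸ mN.isIdeal_lcsIn_top _
  refine ⟨LeibnizMul.IsNilpotent.le_centerIn_top_of_finrank_eq_one ⟨_, ht0⟩ hideal.centerIn hz, ?_⟩
  have his : i - 1 ≤ s := by
    by_contra! hlt
    have hbot : A = ⊥ := by
      rw [hA, eq_bot_iff, ← ht0]
      exact mN.lcsIn_top_antitone hlt
    rw [hbot, finrank_bot] at hdim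
    lia
  have hle : mN.lcsIn ⊤ s ≤ mN.centerIn A := fun z hzs => by
    have hz' := mN.mem_centerIn.1 (mN.lcsIn_top_le_centerIn_top ht0 hzs)
    exact mN.mem_centerIn.2
      ⟨hA ▸ mN.lcsIn_top_antitone his hzs, fun x _ => hz'.2 x Submodule.mem_top⟩
  have hpos : 1 ≤ Module.finrank K (mN.lcsIn ⊤ s) := Submodule.one_le_finrank_iff.2 ht1
  exact Submodule.eq_of_le_of_finrank_le hle (hz ▸ hpos)
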